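/- Let R be a reduced commutative arithmetic ring. Then R is strong 2-coherent, and every finitely 2-presented R-module M has projective dimension at most 1, i.e. there is an exact sequence 0 → P_1 → P_0 → M → 0 with P_0, P_1 projective R-modules. -/

import Mathlib

/-- An `R`-module `M` is finitely `n`-presented if there is an exact sequence
`F_n → F_{n-1} → ⋯ → F_0 → M → 0` of `R`-modules in which every `F_i` is finitely
generated free. (Encoded by an infinite chain of finitely generated free modules which is
required to be exact only at `F_0, …, F_{n-1}` and at `M`.) For `n = 0` this says that `M`
is finitely generated, for `n = 1` that `M` is finitely presented. -/
def IsFinNPresented (R : Type) [Ring R] (n : ℕ) (M : Type) [AddCommGroup M] [Module R M] :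
    Prop :=
  ∃ (k : ℕ → ℕ) (f : ∀ i : ℕ, (Fin (k (i + 1)) → R) →ₗ[R] (Fin (k i) → R))
    (g : (Fin (k 0) → R) →ₗ[R] M),
    Function.Surjective g ∧
    (0 < n → LinearMap.ker g = LinearMap.range (f 0)) ∧
    ∀ i : ℕ, i + 1 < n → LinearMap.ker (f i) = LinearMap.range (f (i + 1))


/-- A ring `R` is strong `n`-coherent if every finitely `n`-presented `R`-module is
finitely `(n+1)`-presented. -/
def StrongNCoherent (R : Type) [Ring R] (n : ℕ) : Prop :=
  ∀ (M : Type) [AddCommGroup M] [Module R M],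
    IsFinNPresented R n M → IsFinNPresented R (n + 1) M


/-- A commutative ring is arithmetic if for every maximal ideal `m` the ideals of the
localization `R_m` are totally ordered by inclusion. -/
def IsArithmeticRing (R : Type) [CommRing R] : Prop :=
  ∀ (m : Ideal R) [m.IsMaximal],
    ∀ I J : Ideal (Localization.AtPrime m), I ≤ J ∨ J ≤ I


/-- An exact sequence `0 → P₁ → P₀ → M → 0` with `P₀`, `P₁` projective `R`-modules;
its existence says that `M` has projective dimension at most `1`. -/
structure ShortProjResolution (R : Type) [Ring R] (M : Type) [AddCommGroup M]
    [Module R M] : Type 1 where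
  P0 : Type
  P1 : Type
  [acg0 : AddCommGroup P0]
  [mod0 : Module R P0]
  [acg1 : AddCommGroup P1]
  [mod1 : Module R P1]
  proj0 : Module.Projective R P0
  proj1 : Module.Projective R P1
  f : P1 →ₗ[R] P0
  g : P0 →ₗ[R] M
  inj : Function.Injective f
  surj : Function.Surjective g
  exact : LinearMap.range f = LinearMap.ker g

theorem aux_isDomain (R : Type) [CommRing R] [IsReduced R] (hR : IsArithmeticRing R)
    (m : Ideal R) [m.IsMaximal] : IsDomain (Localization.AtPrime m) := by
  have : IsReduced (Localization.AtPrime m) :=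
    inferInstanceAs (IsReduced (Localization m.primeCompl))
  have key : ∀ a b : Localization.AtPrime m, a * b = 0 → b ∣ a → a = 0 := by
    rintro a b hab ⟨c, rfl⟩
    apply IsReduced.eq_zero
    refine ⟨2, ?_⟩
    calc (b * c) ^ 2 = (b * c * b) * c := by ring
      _ = 0 := by rw [hab, zero_mul]
  have : NoZeroDivisors (Localization.AtPrime m) := by
    constructor
    intro a b hab
    rcases hR m (Ideal.span {a}) (Ideal.span {b}) with h | h
    · left
      exact key a b hab (Ideal.span_singleton_le_span_singleton.mp h)
    · right
      exact key b a (by rw [mul_comm, hab]) (Ideal.span_singleton_le_span_singleton.mp h)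
  exact NoZeroDivisors.to_isDomain _

theorem aux_flat (R : Type) [CommRing R] [IsReduced R] (hR : IsArithmeticRing R)
    (n : ℕ) (K : Submodule R (Fin n → R)) : Module.Flat R K := by
  apply Module.flat_of_localized_maximal
  intro P hP
  have hd : IsDomain (Localization P.primeCompl) := aux_isDomain R hR P
  have hv : ValuationRing (Localization P.primeCompl) :=
    ValuationRing.iff_ideal_total.mpr ⟨hR P⟩
  rw [← Module.flat_iff_of_isLocalization (Localization P.primeCompl) P.primeCompl]
  refine (Module.Flat.flat_iff_torsion_eq_bot_of_isBezout (R := Localization P.primeCompl)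
    (M := LocalizedModule P.primeCompl K)).mpr ?_
  refine (Submodule.isTorsionFree_iff_torsion_eq_bot (R := Localization P.primeCompl)
    (M := LocalizedModule P.primeCompl K)).mp ?_
  have hF : Module.IsTorsionFree (Localization P.primeCompl)
      (LocalizedModule P.primeCompl (Fin n → R)) := by
    refine (Submodule.isTorsionFree_iff_torsion_eq_bot (R := Localization P.primeCompl)
      (M := LocalizedModule P.primeCompl (Fin n → R))).mpr ?_
    exact Module.Flat.torsion_eq_bot
  exact Function.Injective.moduleIsTorsionFree
    (LocalizedModule.map P.primeCompl K.subtype)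
    (LocalizedModule.map_injective P.primeCompl K.subtype K.injective_subtype)
    (fun c x => map_smul _ c x)

theorem aux_proj (R : Type) [CommRing R] [IsReduced R] (hR : IsArithmeticRing R)
    {a b c : ℕ} (f : (Fin b → R) →ₗ[R] (Fin a → R)) (g : (Fin c → R) →ₗ[R] (Fin b → R))
    (h : LinearMap.ker f = LinearMap.range g) : Module.Projective R (LinearMap.range f) := by
  have h1 := aux_flat R hR a (LinearMap.range f)
  have h2 : Module.FinitePresentation R (LinearMap.range f) := by
    refine Module.finitePresentation_of_surjective f.rangeRestrict f.surjective_rangeRestrict ?_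
    rw [LinearMap.ker_rangeRestrict, h]
    exact Submodule.fg_range _
  exact Module.Flat.projective_of_finitePresentation

theorem aux_ker (R : Type) [CommRing R] [IsReduced R] (hR : IsArithmeticRing R)
    {a b c : ℕ} (f : (Fin b → R) →ₗ[R] (Fin a → R)) (g : (Fin c → R) →ₗ[R] (Fin b → R))
    (h : LinearMap.ker f = LinearMap.range g) :
    ∃ (d : ℕ) (e : (Fin d → R) →ₗ[R] (Fin c → R)), LinearMap.ker g = LinearMap.range e := by
  have h1 := aux_proj R hR f g h
  have h2 : Module.FinitePresentation R (LinearMap.ker f) :=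
    Module.finitePresentation_of_projective_of_exact (LinearMap.ker f).subtype f.rangeRestrict
      (Submodule.injective_subtype _) f.surjective_rangeRestrict (by
        rw [LinearMap.exact_iff, LinearMap.ker_rangeRestrict, Submodule.range_subtype])
  rw [h] at h2
  have h3 := Module.FinitePresentation.fg_ker g.rangeRestrict g.surjective_rangeRestrict
  rw [LinearMap.ker_rangeRestrict] at h3
  have : Module.Finite R (LinearMap.ker g) := Module.Finite.of_fg h3
  obtain ⟨d, e, he⟩ := Module.Finite.exists_fin' R (LinearMap.ker g)
  refine ⟨d, (LinearMap.ker g).subtype ∘ₗ e, ?_⟩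
  rw [LinearMap.range_comp, LinearMap.range_eq_top.mpr he, Submodule.map_top,
    Submodule.range_subtype]

def auxK (k : ℕ → ℕ) (d : ℕ) : ℕ → ℕ
  | 0 => k 0
  | 1 => k 1
  | 2 => k 2
  | (_ + 3) => d

def auxF (R : Type) [CommRing R] (k : ℕ → ℕ) (d : ℕ)
    (f : ∀ i : ℕ, (Fin (k (i + 1)) → R) →ₗ[R] (Fin (k i) → R))
    (e : (Fin d → R) →ₗ[R] (Fin (k 2) → R)) :
    ∀ i : ℕ, (Fin (auxK k d (i + 1)) → R) →ₗ[R] (Fin (auxK k d i) → R)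
  | 0 => f 0
  | 1 => f 1
  | 2 => e
  | (_ + 3) => 0

/-- Let `R` be a reduced commutative arithmetic ring. Then `R` is strong
`2`-coherent, and every finitely `2`-presented `R`-module `M` has projective dimension at
most `1`: there is an exact sequence `0 → P₁ → P₀ → M → 0` with `P₀`, `P₁` projective. -/
theorem reduced_arithmetic_strong_two_coherent_and_pd_le_one
    (R : Type) [CommRing R] [IsReduced R] (hR : IsArithmeticRing R) :
    StrongNCoherent R 2 ∧
      ∀ (M : Type) [AddCommGroup M] [Module R M],
        IsFinNPresented R 2 M → Nonempty (ShortProjResolution R M) := by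
  refine ⟨?_, ?_⟩
  · rintro M _ _ ⟨k, f, g, hg, h0, h1⟩
    obtain ⟨d, e, he⟩ := aux_ker R hR (f 0) (f 1) (h1 0 (by norm_num))
    refine ⟨auxK k d, auxF R k d f e, g, hg, fun _ => h0 (by norm_num), ?_⟩
    intro i hi
    match i, hi with
    | 0, _ => exact h1 0 (by norm_num)
    | 1, _ => exact he
    | (j + 2), hi => omega
  · rintro M _ _ ⟨k, f, g, hg, h0, h1⟩
    have hp := aux_proj R hR (f 0) (f 1) (h1 0 (by norm_num))
    exact ⟨{ P0 := Fin (k 0) → R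
             P1 := LinearMap.range (f 0)
             proj0 := inferInstance
             proj1 := hp
             f := (LinearMap.range (f 0)).subtype
             g := g
             inj := Submodule.injective_subtype _
             surj := hg
             exact := by rw [Submodule.range_subtype, h0 (by norm_num)] }⟩
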